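/- arXiv:2301.09970 — 2 statements merged into one kernel-verified Lean document; each statement's English description precedes it below -/
import Mathlib

section
/- Let D be an almost Dedekind domain. Then the following are equivalent: (i) Crit^ω(D) = ∅; (ii) every nonzero proper principal ideal of D is bounded; (iii) every nonzero finitely generated proper ideal of D is bounded; (iv) every nonzero proper ideal of D is bounded; (v) the ideal function ν_I : Max(D) → ℤ is bounded for every nonzero fractional ideal I of D. -/
/-!
Common definitions: almost Dedekind domains, ideal functions, critical ideals,
the constructible topology on the maximal spectrum.
-/

open scoped Classical Topology

namespace ADPaper

variable (R : Type*) [CommRing R]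

/-- The normalized valuation `v_M(x)` of an element `x` of `R` in the localization at the
maximal ideal `M`: the largest `n` such that the image of `x` lies in the `n`-th power of the
maximal ideal of `R_M` (a junk value if no largest such `n` exists). -/
noncomputable def elemVal (M : MaximalSpectrum R) (x : R) : ℕ :=
  sSup {n : ℕ | algebraMap R (Localization.AtPrime M.asIdeal) x ∈
    IsLocalRing.maximalIdeal (Localization.AtPrime M.asIdeal) ^ n}

/-- The ideal function `ν_I(M) = v_M(I) = min { v_M(x) : x ∈ I, x ≠ 0 }`. -/
noncomputable def nu (I : Ideal R) (M : MaximalSpectrum R) : ℕ :=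
  sInf (elemVal R M '' {x | x ∈ I ∧ x ≠ 0})

/-- `R` is an almost Dedekind domain: the localization at every maximal ideal is a
discrete valuation ring. (The requirement that `R` is not a field is stated separately
where needed.) -/
def AlmostDedekind [IsDomain R] : Prop :=
  ∀ M : MaximalSpectrum R, IsDiscreteValuationRing (Localization.AtPrime M.asIdeal)

/-- An ideal `M` of a commutative ring is critical if it is maximal and contains no nonzero
finitely generated radical ideal. -/
def IsCritical (M : Ideal R) : Prop :=
  M.IsMaximal ∧ ∀ J : Ideal R, J ≠ ⊥ → J.FG → J.IsRadical → ¬ J ≤ M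

/-- `Crit R`: the set of critical maximal ideals, i.e. maximal ideals containing no
nonzero finitely generated radical ideal. -/
def Crit : Set (MaximalSpectrum R) :=
  {M | ∀ J : Ideal R, J ≠ ⊥ → J.FG → J.IsRadical → ¬ J ≤ M.asIdeal}

/-- `CritN R n`: the set of `n`-critical maximal ideals, i.e. maximal ideals containing no
nonzero finitely generated ideal whose ideal function is bounded by `n`. -/
def CritN (n : ℕ) : Set (MaximalSpectrum R) :=
  {M | ∀ J : Ideal R, J ≠ ⊥ → J.FG → (∀ N, nu R J N ≤ n) → ¬ J ≤ M.asIdeal}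

/-- `CritOmega R`: the set of `ω`-critical maximal ideals, i.e. maximal ideals containing no
nonzero finitely generated ideal whose ideal function is bounded. -/
def CritOmega : Set (MaximalSpectrum R) :=
  {M | ∀ J : Ideal R, J ≠ ⊥ → J.FG → (∃ n : ℕ, ∀ N, nu R J N ≤ n) → ¬ J ≤ M.asIdeal}

/-- The constructible topology on the maximal spectrum: generated by the sets
`V(J) = {M | J ≤ M}` and their complements, for `J` finitely generated. -/
def constrTop : TopologicalSpace (MaximalSpectrum R) :=
  TopologicalSpace.generateFrom
    {S | ∃ J : Ideal R, J.FG ∧ (S = {M | J ≤ M.asIdeal} ∨ S = {M | ¬ J ≤ M.asIdeal})}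

variable [IsDomain R]

/-- The localization `R_M` regarded as a subalgebra of the fraction field. -/
noncomputable def locSubalgebra (M : MaximalSpectrum R) : Subalgebra R (FractionRing R) :=
  Localization.subalgebra (FractionRing R) M.asIdeal.primeCompl
    (fun _s hs => mem_nonZeroDivisors_of_ne_zero fun h => hs (h ▸ M.asIdeal.zero_mem))

/-- The overring `⋂ {R_M : M ∈ X}` of `R` inside the fraction field (equal to the whole
fraction field when `X = ∅`). -/
noncomputable def interLoc (X : Set (MaximalSpectrum R)) : Subalgebra R (FractionRing R) :=
  ⨅ M ∈ X, locSubalgebra R M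

/-- The valuation `v_M` extended to the fraction field: `v_M(a/s) = v_M(a) - v_M(s)`. -/
noncomputable def elemValK (M : MaximalSpectrum R) (x : FractionRing R) : ℤ :=
  (elemVal R M (IsLocalization.sec (nonZeroDivisors R) x).1 : ℤ) -
    (elemVal R M ((IsLocalization.sec (nonZeroDivisors R) x).2 : R) : ℤ)

/-- The ideal function of a fractional ideal. -/
noncomputable def nuK (I : FractionalIdeal (nonZeroDivisors R) (FractionRing R))
    (M : MaximalSpectrum R) : ℤ :=
  sInf (elemValK R M '' {x | x ∈ I ∧ x ≠ 0})

end ADPaper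

namespace ADPaper

section

variable {R : Type*} [CommRing R]

theorem nu_le_elemVal {I : Ideal R} (M : MaximalSpectrum R) {x : R} (hxI : x ∈ I)
    (hx : x ≠ 0) : nu R I M ≤ elemVal R M x :=
  Nat.sInf_le ⟨x, ⟨hxI, hx⟩, rfl⟩

theorem exists_elemVal_eq_nu {I : Ideal R} (hI : I ≠ ⊥) (M : MaximalSpectrum R) :
    ∃ x ∈ I, x ≠ 0 ∧ elemVal R M x = nu R I M := by
  obtain ⟨y, hyI, hy⟩ := Submodule.exists_mem_ne_zero_of_ne_bot hI
  have hne : (elemVal R M '' {x | x ∈ I ∧ x ≠ 0}).Nonempty := ⟨_, y, ⟨hyI, hy⟩, rfl⟩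
  obtain ⟨x, ⟨hxI, hx⟩, hxv⟩ := Nat.sInf_mem hne
  exact ⟨x, hxI, hx, hxv⟩

theorem nu_anti {I J : Ideal R} (hI : I ≠ ⊥) (hIJ : I ≤ J) (M : MaximalSpectrum R) :
    nu R J M ≤ nu R I M := by
  obtain ⟨x, hxI, hx, hxv⟩ := exists_elemVal_eq_nu hI M
  exact hxv ▸ nu_le_elemVal M (hIJ hxI) hx

variable [IsDomain R]

theorem algebraMap_localization_injective (M : MaximalSpectrum R) :
    Function.Injective (algebraMap R (Localization.AtPrime M.asIdeal)) :=
  IsLocalization.injective _ M.asIdeal.primeCompl_le_nonZeroDivisors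

theorem AlmostDedekind.elemVal_eq_addVal (hAD : AlmostDedekind R) (M : MaximalSpectrum R)
    {x : R} (hx : x ≠ 0) :
    haveI := hAD M
    (elemVal R M x : ℕ∞) = IsDiscreteValuationRing.addVal (Localization.AtPrime M.asIdeal)
      (algebraMap R (Localization.AtPrime M.asIdeal) x) := by
  have := hAD M
  obtain ⟨ϖ, hϖ⟩ :=
    IsDiscreteValuationRing.exists_irreducible (Localization.AtPrime M.asIdeal)
  have hx' : algebraMap R (Localization.AtPrime M.asIdeal) x ≠ 0 := fun h =>
    hx ((map_eq_zero_iff _ (algebraMap_localization_injective M)).1 h)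
  obtain ⟨k, u, hk⟩ := IsDiscreteValuationRing.eq_unit_mul_pow_irreducible hx' hϖ
  rw [IsDiscreteValuationRing.addVal_def _ u hϖ k hk]
  have hset : {n : ℕ | algebraMap R (Localization.AtPrime M.asIdeal) x ∈
      IsLocalRing.maximalIdeal (Localization.AtPrime M.asIdeal) ^ n} = Set.Iic k := by
    ext n
    rw [Set.mem_ofPred_eq, Set.mem_Iic, hϖ.maximalIdeal_eq, Ideal.span_singleton_pow,
      Ideal.mem_span_singleton, ← IsDiscreteValuationRing.addVal_le_iff_dvd, hϖ.addVal_pow,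
      IsDiscreteValuationRing.addVal_def _ u hϖ k hk, Nat.cast_le]
  rw [elemVal, hset, csSup_Iic]

theorem AlmostDedekind.elemVal_mul (hAD : AlmostDedekind R) (M : MaximalSpectrum R)
    {x y : R} (hx : x ≠ 0) (hy : y ≠ 0) :
    elemVal R M (x * y) = elemVal R M x + elemVal R M y := by
  have := hAD M
  have h : (elemVal R M (x * y) : ℕ∞) = elemVal R M x + elemVal R M y := by
    rw [hAD.elemVal_eq_addVal M hx, hAD.elemVal_eq_addVal M hy,
      hAD.elemVal_eq_addVal M (mul_ne_zero hx hy), map_mul, IsDiscreteValuationRing.addVal_mul]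
  exact_mod_cast h

theorem AlmostDedekind.elemVal_of_isUnit (hAD : AlmostDedekind R) (M : MaximalSpectrum R)
    {x : R} (hx : IsUnit x) : elemVal R M x = 0 := by
  obtain ⟨y, hxy⟩ := hx.exists_right_inv
  have hone := hAD.elemVal_mul M (one_ne_zero (α := R)) one_ne_zero
  have hmul := hAD.elemVal_mul M hx.ne_zero (right_ne_zero_of_mul_eq_one hxy)
  rw [mul_one] at hone
  rw [hxy] at hmul
  omega

theorem AlmostDedekind.nu_mul_le (hAD : AlmostDedekind R) {I J : Ideal R} (hI : I ≠ ⊥)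
    (hJ : J ≠ ⊥) (M : MaximalSpectrum R) : nu R (I * J) M ≤ nu R I M + nu R J M := by
  obtain ⟨x, hxI, hx, hxv⟩ := exists_elemVal_eq_nu hI M
  obtain ⟨y, hyJ, hy, hyv⟩ := exists_elemVal_eq_nu hJ M
  rw [← hxv, ← hyv, ← hAD.elemVal_mul M hx hy]
  exact nu_le_elemVal M (Ideal.mul_mem_mul hxI hyJ) (mul_ne_zero hx hy)

theorem AlmostDedekind.nu_span_singleton (hAD : AlmostDedekind R) {a : R} (ha : a ≠ 0)
    (M : MaximalSpectrum R) : nu R (Ideal.span {a}) M = elemVal R M a := by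
  refine le_antisymm (nu_le_elemVal M (Ideal.mem_span_singleton_self a) ha) ?_
  obtain ⟨x, hxI, hx, hxv⟩ :=
    exists_elemVal_eq_nu (mt Ideal.span_singleton_eq_bot.1 ha) M
  obtain ⟨b, rfl⟩ := Ideal.mem_span_singleton.1 hxI
  rw [← hxv, hAD.elemVal_mul M ha (right_ne_zero_of_mul hx)]
  exact Nat.le_add_right _ _

/-- Nonzero primes of an almost Dedekind domain are maximal. -/
theorem AlmostDedekind.isMaximal_of_isPrime (hAD : AlmostDedekind R) {P : Ideal R}
    (hP : P.IsPrime) (hP0 : P ≠ ⊥) : P.IsMaximal := by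
  obtain ⟨M, hM, hPM⟩ := P.exists_le_maximal hP.ne_top
  let N : MaximalSpectrum R := ⟨M, hM⟩
  have := hAD N
  have hdisj : Disjoint (N.asIdeal.primeCompl : Set R) (P : Set R) :=
    Set.disjoint_left.2 fun x hx hxP => hx (hPM hxP)
  have hprime : (P.map (algebraMap R (Localization.AtPrime N.asIdeal))).IsPrime :=
    IsLocalization.isPrime_of_isPrime_disjoint _ _ P hP hdisj
  have hne : P.map (algebraMap R (Localization.AtPrime N.asIdeal)) ≠ ⊥ := fun h =>
    hP0 ((Ideal.map_eq_bot_iff_of_injective (algebraMap_localization_injective N)).1 h)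
  have hmax := IsLocalRing.eq_maximalIdeal (hprime.isMaximal hne)
  have hcomap := congrArg (Ideal.under R) hmax
  rw [IsLocalization.under_map_of_isPrime_disjoint N.asIdeal.primeCompl _ hP hdisj,
    Localization.AtPrime.under_maximalIdeal] at hcomap
  exact hcomap ▸ hM

/-- If every maximal ideal contains a nonzero bounded finitely generated ideal, then so does
every nonzero ideal. -/
theorem AlmostDedekind.exists_bounded_fg_le (hAD : AlmostDedekind R)
    (hcrit : CritOmega R = ∅) {I : Ideal R} (hI : I ≠ ⊥) :
    ∃ J : Ideal R, J ≠ ⊥ ∧ J.FG ∧ (∃ n : ℕ, ∀ N, nu R J N ≤ n) ∧ J ≤ I := by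
  by_contra hno
  let S : Set (Ideal R) :=
    {K | ∀ J : Ideal R, J ≠ ⊥ → J.FG → (∃ n : ℕ, ∀ N, nu R J N ≤ n) → ¬ J ≤ K}
  have hIS : I ∈ S := fun J h0 hfg hb hle => hno ⟨J, h0, hfg, hb, hle⟩
  obtain ⟨P, hIP, hP⟩ := zorn_le_nonempty₀ S (fun c hcS hc y hy =>
    ⟨sSup c, fun J h0 hfg hb hle => by
      obtain ⟨K, hKc, hJK⟩ := (CompleteLattice.isCompactElement_iff_le_of_directed_sSup_le _ J).1
        ((Submodule.fg_iff_compact J).1 hfg) c ⟨y, hy⟩ hc.directedOn hle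
      exact hcS hKc J h0 hfg hb hJK, fun K hK => le_sSup hK⟩) I hIS
  have hP0 : P ≠ ⊥ := ne_bot_of_le_ne_bot hI hIP
  have henlarge : ∀ x, x ∉ P → ∃ J : Ideal R, J ≠ ⊥ ∧ J.FG ∧
      (∃ n : ℕ, ∀ N, nu R J N ≤ n) ∧ J ≤ P ⊔ Ideal.span {x} := by
    intro x hx
    by_contra hJ
    refine hx (hP.le_of_ge (y := P ⊔ Ideal.span {x})
      (fun J h0 hfg hb hle => hJ ⟨J, h0, hfg, hb, hle⟩) le_sup_left ?_)
    exact Ideal.mem_sup_right (Ideal.mem_span_singleton_self x)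
  have htop : P ≠ ⊤ := by
    rintro rfl
    refine hP.prop ⊤ top_ne_bot ⟨{1}, by simp⟩ ⟨0, fun N => ?_⟩ le_rfl
    exact (nu_le_elemVal N Submodule.mem_top one_ne_zero).trans
      (hAD.elemVal_of_isUnit N isUnit_one).le
  have hprime : P.IsPrime := by
    refine ⟨htop, fun {x y} hxy => ?_⟩
    by_contra! h
    obtain ⟨J, hJ0, hJfg, ⟨m, hm⟩, hJ⟩ := henlarge x h.1
    obtain ⟨K, hK0, hKfg, ⟨n, hn⟩, hK⟩ := henlarge y h.2
    refine hP.prop (J * K) (mul_ne_zero hJ0 hK0) (hJfg.mul hKfg)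
      ⟨m + n, fun N => (hAD.nu_mul_le hJ0 hK0 N).trans (add_le_add (hm N) (hn N))⟩
      ((Ideal.mul_mono hJ hK).trans ?_)
    rw [Ideal.sup_mul, Ideal.mul_sup, Ideal.mul_sup, Ideal.span_singleton_mul_span_singleton]
    exact sup_le (sup_le Ideal.mul_le_left Ideal.mul_le_left)
      (sup_le Ideal.mul_le_right (by simpa [Ideal.span_le] using hxy))
  have hmem : (⟨P, hAD.isMaximal_of_isPrime hprime hP0⟩ : MaximalSpectrum R) ∈ CritOmega R :=
    hP.prop
  simp [hcrit] at hmem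

/-- The extended valuation may be computed from any representation as a fraction. -/
theorem AlmostDedekind.elemValK_add (hAD : AlmostDedekind R) (M : MaximalSpectrum R)
    {x : FractionRing R} {r s : R} (hr : r ≠ 0) (hs : s ≠ 0)
    (hx : x * algebraMap R (FractionRing R) s = algebraMap R (FractionRing R) r) :
    elemValK R M x + elemVal R M s = elemVal R M r := by
  have hinj := IsFractionRing.injective R (FractionRing R)
  have hsec := IsLocalization.sec_spec (nonZeroDivisors R) x
  rw [elemValK]
  set p := (IsLocalization.sec (nonZeroDivisors R) x).1
  set q : R := ((IsLocalization.sec (nonZeroDivisors R) x).2 : R) with hqdef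
  have hq : q ≠ 0 := nonZeroDivisors.coe_ne_zero _
  have hcross : p * s = r * q := by
    apply hinj
    rw [map_mul, map_mul, ← hsec, ← hx]
    ring
  have hp : p ≠ 0 := left_ne_zero_of_mul (hcross ▸ mul_ne_zero hr hq)
  have h := congrArg (elemVal R M) hcross
  rw [hAD.elemVal_mul M hp hs, hAD.elemVal_mul M hr hq] at h
  omega

theorem AlmostDedekind.elemValK_algebraMap (hAD : AlmostDedekind R) (M : MaximalSpectrum R)
    {r : R} (hr : r ≠ 0) :
    elemValK R M (algebraMap R (FractionRing R) r) = elemVal R M r := by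
  have h := hAD.elemValK_add M (x := algebraMap R (FractionRing R) r) hr one_ne_zero (by simp)
  rwa [hAD.elemVal_of_isUnit M isUnit_one, Nat.cast_zero, add_zero] at h

/-- A fractional ideal `I` with common denominator `d` satisfies `-v_M(d) ≤ v_M(x)` for every
nonzero `x ∈ I`. -/
theorem AlmostDedekind.exists_neg_elemVal_le (hAD : AlmostDedekind R)
    (I : FractionalIdeal (nonZeroDivisors R) (FractionRing R)) :
    ∃ d : R, d ≠ 0 ∧ ∀ M, ∀ x ∈ I, x ≠ 0 → -(elemVal R M d : ℤ) ≤ elemValK R M x := by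
  obtain ⟨d, hd, hdI⟩ := I.isFractional
  have hd0 := nonZeroDivisors.ne_zero hd
  refine ⟨d, hd0, fun M x hxI hx => ?_⟩
  obtain ⟨r, hr⟩ := hdI x hxI
  rw [Algebra.smul_def, mul_comm] at hr
  have hr0 : r ≠ 0 := by
    rintro rfl
    rw [map_zero, eq_comm, mul_eq_zero] at hr
    exact hr.elim hx fun h => hd0 ((map_eq_zero_iff _
      (IsFractionRing.injective R (FractionRing R))).1 h)
  have h := hAD.elemValK_add M hr0 hd0 hr.symm
  omega

theorem AlmostDedekind.elemVal_le_nuK_span_singleton (hAD : AlmostDedekind R) {a : R}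
    (ha : a ≠ 0) (M : MaximalSpectrum R) :
    (elemVal R M a : ℤ) ≤ nuK R (Ideal.span {a} : Ideal R) M := by
  refine le_csInf ⟨_, algebraMap R (FractionRing R) a, ⟨?_, ?_⟩, rfl⟩ ?_
  · exact FractionalIdeal.mem_coeIdeal_of_mem _ (Ideal.mem_span_singleton_self a)
  · exact fun h => ha ((map_eq_zero_iff _ (IsFractionRing.injective R (FractionRing R))).1 h)
  · rintro _ ⟨x, ⟨hxI, hx⟩, rfl⟩
    obtain ⟨y, hy, rfl⟩ := (FractionalIdeal.mem_coeIdeal _).1 hxI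
    have hy0 : y ≠ 0 := fun h => hx (by rw [h, map_zero])
    rw [hAD.elemValK_algebraMap M hy0, ← hAD.nu_span_singleton ha]
    exact_mod_cast nu_le_elemVal M hy hy0

end

/-- For an almost Dedekind domain `D`, the following are equivalent:
(i) `Critʷ(D) = ∅`; (ii) every nonzero proper principal ideal is bounded; (iii) every
nonzero finitely generated proper ideal is bounded; (iv) every nonzero proper ideal is
bounded; (v) `ν_I` is bounded for every nonzero fractional ideal `I`. -/
theorem statement3 (R : Type*) [CommRing R] [IsDomain R] (hR : ¬ IsField R)
    (hAD : AlmostDedekind R) :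
    List.TFAE
      [CritOmega R = ∅,
       ∀ a : R, Ideal.span {a} ≠ ⊥ → Ideal.span {a} ≠ ⊤ →
         ∃ n : ℕ, ∀ M, nu R (Ideal.span {a}) M ≤ n,
       ∀ I : Ideal R, I.FG → I ≠ ⊥ → I ≠ ⊤ → ∃ n : ℕ, ∀ M, nu R I M ≤ n,
       ∀ I : Ideal R, I ≠ ⊥ → I ≠ ⊤ → ∃ n : ℕ, ∀ M, nu R I M ≤ n,
       ∀ I : FractionalIdeal (nonZeroDivisors R) (FractionRing R), I ≠ 0 →
         ∃ B : ℕ, ∀ M, |nuK R I M| ≤ (B : ℤ)] := by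
  have bounded_of_principal : (∀ a : R, Ideal.span {a} ≠ ⊥ → Ideal.span {a} ≠ ⊤ →
      ∃ n : ℕ, ∀ M, nu R (Ideal.span {a}) M ≤ n) →
      ∀ a : R, a ≠ 0 → ∃ n : ℕ, ∀ M, elemVal R M a ≤ n := by
    intro h a ha
    by_cases hu : IsUnit a
    · exact ⟨0, fun M => (hAD.elemVal_of_isUnit M hu).le⟩
    · obtain ⟨n, hn⟩ := h a (mt Ideal.span_singleton_eq_bot.1 ha)
        (mt Ideal.span_singleton_eq_top.1 hu)
      exact ⟨n, fun M => hAD.nu_span_singleton ha M ▸ hn M⟩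
  tfae_have 1 → 2 := by
    intro hcrit a ha _
    obtain ⟨J, hJ0, -, ⟨n, hn⟩, hJ⟩ := hAD.exists_bounded_fg_le hcrit ha
    exact ⟨n, fun M => (nu_anti hJ0 hJ M).trans (hn M)⟩
  tfae_have 2 → 1 := by
    refine fun h => Set.eq_empty_iff_forall_notMem.2 fun M hM => ?_
    obtain ⟨a, haM, ha⟩ := Submodule.exists_mem_ne_zero_of_ne_bot
      (Ring.ne_bot_of_isMaximal_of_not_isField M.isMaximal hR)
    have hle : Ideal.span {a} ≤ M.asIdeal := (Ideal.span_singleton_le_iff_mem _).2 haM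
    have hbot : Ideal.span {a} ≠ ⊥ := mt Ideal.span_singleton_eq_bot.1 ha
    exact hM _ hbot (Submodule.fg_span_singleton a)
      (h a hbot (ne_top_of_le_ne_top M.isMaximal.ne_top hle)) hle
  tfae_have 2 → 4 := by
    intro h I hI _
    obtain ⟨a, haI, ha⟩ := Submodule.exists_mem_ne_zero_of_ne_bot hI
    obtain ⟨n, hn⟩ := bounded_of_principal h a ha
    exact ⟨n, fun M => (nu_le_elemVal M haI ha).trans (hn M)⟩
  tfae_have 4 → 3 := fun h I _ => h I
  tfae_have 3 → 2 := fun h a => h _ (Submodule.fg_span_singleton a)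
  tfae_have 2 → 5 := by
    intro h I hI
    obtain ⟨d, hd, hle⟩ := hAD.exists_neg_elemVal_le I
    obtain ⟨x, hxI, hx⟩ := Submodule.exists_mem_ne_zero_of_ne_bot
      (mt FractionalIdeal.coeToSubmodule_eq_bot.1 hI)
    have hxnum : (IsLocalization.sec (nonZeroDivisors R) x).1 ≠ 0 := fun h0 => by
      have hsec := IsLocalization.sec_spec (nonZeroDivisors R) x
      rw [h0, map_zero, mul_eq_zero] at hsec
      exact hsec.elim hx (IsLocalization.to_map_ne_zero_of_mem_nonZeroDivisors _ le_rfl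
        (IsLocalization.sec (nonZeroDivisors R) x).2.2)
    obtain ⟨m, hm⟩ := bounded_of_principal h d hd
    obtain ⟨n, hn⟩ := bounded_of_principal h _ hxnum
    refine ⟨m + n, fun M => abs_le.2 ⟨?_, ?_⟩⟩
    · refine le_csInf ⟨_, x, ⟨hxI, hx⟩, rfl⟩ ?_
      rintro _ ⟨y, ⟨hyI, hy⟩, rfl⟩
      have h₁ := hle M y hyI hy
      have h₂ := hm M
      push_cast
      omega
    · have hbdd : BddBelow (elemValK R M '' {x | x ∈ I ∧ x ≠ 0}) :=
        ⟨_, by rintro _ ⟨y, ⟨hyI, hy⟩, rfl⟩; exact hle M y hyI hy⟩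
      refine (csInf_le hbdd ⟨x, ⟨hxI, hx⟩, rfl⟩).trans ?_
      have h₂ := hn M
      rw [elemValK]
      push_cast
      omega
  tfae_have 5 → 2 := by
    intro h a ha _
    have ha0 : a ≠ 0 := mt Ideal.span_singleton_eq_bot.2 ha
    obtain ⟨B, hB⟩ := h (Ideal.span {a} : Ideal R) (FractionalIdeal.coeIdeal_ne_zero.2 ha)
    refine ⟨B, fun M => ?_⟩
    rw [hAD.nu_span_singleton ha0]
    exact_mod_cast (hAD.elemVal_le_nuK_span_singleton ha0 M).trans
      ((le_abs_self _).trans (hB M))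
  tfae_finish

end ADPaper
end

section
/- Let D be an almost Dedekind domain that is not a field such that the set Crit(D) of critical maximal ideals is finite. Then D is not completely unbounded; that is, there exists a nonzero proper principal ideal of D that is bounded. -/
/-!
Common definitions: almost Dedekind domains, ideal functions, critical ideals,
the constructible topology on the maximal spectrum.
-/

open scoped Classical Topology

namespace ADPaper

open IsDiscreteValuationRing

/-- In a discrete valuation ring, the `n`-th power of the maximal ideal consists of the elements
of valuation at least `n`. -/
theorem mem_maximalIdeal_pow_iff_le_addVal {A : Type*} [CommRing A] [IsDomain A]
    [IsDiscreteValuationRing A] (n : ℕ) (x : A) :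
    x ∈ IsLocalRing.maximalIdeal A ^ n ↔ (n : ℕ∞) ≤ addVal A x := by
  obtain ⟨p, hp⟩ := exists_irreducible A
  have hn : addVal A (p ^ n) = n := by
    rw [addVal_pow, addVal_uniformizer hp, nsmul_one]
  rw [(irreducible_iff_uniformizer p).1 hp, Ideal.span_singleton_pow, Ideal.mem_span_singleton,
    ← hn, addVal_le_iff_dvd]

theorem algebraMap_localization_injective_s13 {R : Type*} [CommRing R] [IsDomain R]
    (N : MaximalSpectrum R) :
    Function.Injective (algebraMap R (Localization.AtPrime N.asIdeal)) :=
  IsLocalization.injective _ N.asIdeal.primeCompl_le_nonZeroDivisors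

section Valuation

variable {R : Type*} [CommRing R] [IsDomain R] (N : MaximalSpectrum R)
  [IsDiscreteValuationRing (Localization.AtPrime N.asIdeal)]

/-- The `N`-adic valuation on `R`, with values in `ℕ∞`. -/
noncomputable def locVal (x : R) : ℕ∞ :=
  addVal (Localization.AtPrime N.asIdeal) (algebraMap R (Localization.AtPrime N.asIdeal) x)

theorem locVal_mul (x y : R) : locVal N (x * y) = locVal N x + locVal N y := by
  simp [locVal]

theorem locVal_pow (x : R) (n : ℕ) : locVal N (x ^ n) = n * locVal N x := by
  simp [locVal]

theorem locVal_ne_top {x : R} (hx : x ≠ 0) : locVal N x ≠ ⊤ := by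
  rw [locVal, Ne, addVal_eq_top_iff]
  exact fun h => hx (algebraMap_localization_injective_s13 N (by simpa using h))

theorem locVal_eq_zero_of_notMem {x : R} (hx : x ∉ N.asIdeal) : locVal N x = 0 := by
  rw [locVal, addVal_eq_zero_iff]
  exact IsLocalization.map_units (Localization.AtPrime N.asIdeal)
    (⟨x, hx⟩ : N.asIdeal.primeCompl)

theorem exists_notMem_dvd_mul_of_locVal_le {x y : R} (h : locVal N x ≤ locVal N y) :
    ∃ s ∉ N.asIdeal, x ∣ s * y := by
  obtain ⟨c, hc⟩ := addVal_le_iff_dvd.1 h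
  obtain ⟨⟨r, t⟩, hr⟩ := IsLocalization.surj N.asIdeal.primeCompl c
  refine ⟨t, t.2, r, algebraMap_localization_injective_s13 N ?_⟩
  rw [map_mul, map_mul, hc, ← hr]
  ring

theorem exists_locVal_eq_one : ∃ x : R, locVal N x = 1 := by
  obtain ⟨p, hp⟩ := exists_irreducible (Localization.AtPrime N.asIdeal)
  obtain ⟨⟨r, t⟩, hr⟩ := IsLocalization.surj N.asIdeal.primeCompl p
  refine ⟨r, ?_⟩
  have ht : locVal N (t : R) = 0 := locVal_eq_zero_of_notMem N t.2
  unfold locVal at ht ⊢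
  rw [← hr, addVal_mul, ht, addVal_uniformizer hp, add_zero]

theorem le_locVal_of_mem_pow {x : R} {n : ℕ} (hx : x ∈ N.asIdeal ^ n) : (n : ℕ∞) ≤ locVal N x := by
  rw [locVal, ← mem_maximalIdeal_pow_iff_le_addVal, ← Localization.AtPrime.map_eq_maximalIdeal,
    ← Ideal.map_pow]
  exact Ideal.mem_map_of_mem _ hx

theorem nu_span_singleton_le {x : R} (hx : x ≠ 0) {n : ℕ} (h : locVal N x ≤ n) :
    nu R (Ideal.span {x}) N ≤ n := by
  have hnu : nu R (Ideal.span {x}) N ≤ elemVal R N x :=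
    Nat.sInf_le ⟨x, ⟨Ideal.mem_span_singleton_self x, hx⟩, rfl⟩
  refine hnu.trans (csSup_le ⟨0, by simp⟩ fun m hm => ?_)
  exact_mod_cast ((mem_maximalIdeal_pow_iff_le_addVal m _).1 hm).trans h

/-- A nonzero radical ideal has value at most one at every maximal ideal. -/
theorem exists_mem_locVal_le_one {J : Ideal R} (hJ : J ≠ ⊥) (hrad : J.IsRadical) :
    ∃ y ∈ J, locVal N y ≤ 1 := by
  obtain ⟨z, hz, hz0⟩ := Submodule.exists_mem_ne_zero_of_ne_bot hJ
  obtain ⟨p, hp⟩ := exists_locVal_eq_one N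
  obtain ⟨m, hm⟩ := ENat.ne_top_iff_exists.1 (locVal_ne_top N hz0)
  obtain ⟨s, hs, hdvd⟩ := exists_notMem_dvd_mul_of_locVal_le N (x := z) (y := p ^ m)
    (by rw [locVal_pow, hp, mul_one, hm])
  refine ⟨s * p, hrad ⟨m + 1, J.mem_of_dvd ?_ hz⟩, ?_⟩
  · exact hdvd.trans ⟨s ^ m * p, by ring⟩
  · rw [locVal_mul, hp, locVal_eq_zero_of_notMem N hs, zero_add]

/-- If a finitely generated ideal has values at least `v_N(a)` at `N`, then a single element
outside `N` multiplies it into the ideal generated by `a`. -/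
theorem exists_notMem_forall_dvd_mul {I : Ideal R} (hI : I.FG) {a : R}
    (h : ∀ y ∈ I, locVal N a ≤ locVal N y) : ∃ s ∉ N.asIdeal, ∀ y ∈ I, a ∣ s * y := by
  obtain ⟨T, rfl⟩ := hI
  choose! s hs hdvd using fun y (hy : y ∈ Ideal.span (T : Set R)) =>
    exists_notMem_dvd_mul_of_locVal_le N (h y hy)
  refine ⟨∏ t ∈ T, s t, ?_, fun y hy => ?_⟩
  · intro hmem
    obtain ⟨t, ht, hst⟩ := (Ideal.IsPrime.prod_mem_iff (hp := N.isMaximal.isPrime)).1 hmem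
    exact hs t (Ideal.subset_span ht) hst
  · induction hy using Submodule.span_induction with
    | mem t ht =>
      exact (hdvd t (Ideal.subset_span ht)).trans
        (mul_dvd_mul_right (Finset.dvd_prod_of_mem s ht) t)
    | zero => simp
    | add x y _ _ hx hy => rw [mul_add]; exact dvd_add hx hy
    | smul c x _ hx => rw [smul_eq_mul, mul_left_comm]; exact hx.mul_left c

end Valuation

section Boundedness

variable {R : Type*} [CommRing R] [IsDomain R]
  [∀ N : MaximalSpectrum R, IsDiscreteValuationRing (Localization.AtPrime N.asIdeal)]

/-- The ideal of elements off whose zero locus the valuations of `a` are bounded. -/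
def boundingIdeal (a : R) : Ideal R where
  carrier := {x | ∃ n : ℕ, ∀ N : MaximalSpectrum R, x ∉ N.asIdeal → locVal N a ≤ n}
  zero_mem' := ⟨0, fun N h => absurd N.asIdeal.zero_mem h⟩
  add_mem' := by
    rintro x y ⟨m, hm⟩ ⟨n, hn⟩
    refine ⟨max m n, fun N h => ?_⟩
    by_cases hx : x ∈ N.asIdeal
    · exact (hn N fun hy => h (N.asIdeal.add_mem hx hy)).trans (by simp)
    · exact (hm N hx).trans (by simp)
  smul_mem' := by
    rintro c x ⟨n, hn⟩
    exact ⟨n, fun N h => hn N fun hx => h (N.asIdeal.mul_mem_left c hx)⟩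

/-- A nonzero element lying in no critical maximal ideal has bounded valuations. -/
theorem exists_forall_locVal_le {a : R} (ha : a ≠ 0) (hcrit : ∀ N ∈ Crit R, a ∉ N.asIdeal) :
    ∃ n : ℕ, ∀ N : MaximalSpectrum R, locVal N a ≤ n := by
  suffices h : boundingIdeal a = ⊤ by
    obtain ⟨n, hn⟩ := (Ideal.eq_top_iff_one _).1 h
    exact ⟨n, fun N => hn N fun h1 => N.isMaximal.ne_top ((Ideal.eq_top_iff_one _).2 h1)⟩
  by_contra htop
  obtain ⟨M, hM, hle⟩ := Ideal.exists_le_maximal _ htop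
  let N : MaximalSpectrum R := ⟨M, hM⟩
  by_cases hN : N ∈ Crit R
  · refine hcrit N hN (hle ⟨0, fun N' h => ?_⟩)
    simp [locVal_eq_zero_of_notMem N' h]
  · simp only [Crit, Set.mem_ofPred_eq, not_forall, not_not] at hN
    obtain ⟨J, hJ, hfg, hrad, hJN⟩ := hN
    obtain ⟨k, hk⟩ := ENat.ne_top_iff_exists.1 (locVal_ne_top N ha)
    obtain ⟨s, hs, hdvd⟩ := exists_notMem_forall_dvd_mul N (hfg.pow (n := k)) (a := a)
      fun y hy => hk ▸ le_locVal_of_mem_pow N (Ideal.pow_right_mono hJN k hy)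
    refine hs (hle ⟨k, fun N' hs' => ?_⟩)
    obtain ⟨y, hy, hy1⟩ := exists_mem_locVal_le_one N' hJ hrad
    obtain ⟨b, hb⟩ := hdvd (y ^ k) (Ideal.pow_mem_pow hy k)
    calc locVal N' a ≤ locVal N' (a * b) := by rw [locVal_mul]; exact le_self_add
      _ = k * locVal N' y := by
        rw [← hb, locVal_mul, locVal_eq_zero_of_notMem N' hs', zero_add, locVal_pow]
      _ ≤ k := mul_le_of_le_one_right' hy1

theorem exists_forall_locVal_le_of_finite [Finite (MaximalSpectrum R)] {a : R} (ha : a ≠ 0) :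
    ∃ n : ℕ, ∀ N : MaximalSpectrum R, locVal N a ≤ n := by
  obtain ⟨n, hn⟩ := (Set.finite_range fun N : MaximalSpectrum R => (locVal N a).toNat).bddAbove
  refine ⟨n, fun N => ?_⟩
  rw [← ENat.natCast_toNat (locVal_ne_top N ha)]
  exact_mod_cast hn ⟨N, rfl⟩

end Boundedness

/-- If there are finitely many critical maximal ideals, an ideal contained in none of them
contains a nonzero element lying in none of them. -/
theorem exists_mem_ne_zero_forall_crit_notMem {R : Type*} [CommRing R] [IsDomain R]
    (hfin : (Crit R).Finite) {J : Ideal R} (hJ : J ≠ ⊥) (hcrit : ∀ N ∈ Crit R, ¬ J ≤ N.asIdeal) :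
    ∃ a ∈ J, a ≠ 0 ∧ ∀ N ∈ Crit R, a ∉ N.asIdeal := by
  by_contra! hcon
  let S : Finset (Ideal R) := insert ⊥ (hfin.toFinset.image MaximalSpectrum.asIdeal)
  have hsub : (J : Set R) ⊆ ⋃ P ∈ (S : Set (Ideal R)), (P : Set R) := by
    intro a ha
    simp only [S, Set.mem_iUnion]
    by_cases h0 : a = 0
    · exact ⟨⊥, by simp, by simpa using h0⟩
    · obtain ⟨N, hN, haN⟩ := hcon a ha h0
      exact ⟨N.asIdeal, by simpa using Or.inr ⟨N, hN, rfl⟩, haN⟩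
  have hprime : ∀ P ∈ S, P ≠ ⊥ → P ≠ ⊥ → P.IsPrime := by
    intro P hP hP0 _
    simp only [S, Finset.mem_insert, Finset.mem_image] at hP
    obtain rfl | ⟨N, _, rfl⟩ := hP
    · exact absurd rfl hP0
    · exact N.isMaximal.isPrime
  obtain ⟨P, hP, hJP⟩ := (Ideal.subset_union_prime ⊥ ⊥ hprime).1 hsub
  simp only [S, Finset.mem_insert, Finset.mem_image, Set.Finite.mem_toFinset] at hP
  obtain rfl | ⟨N, hN, rfl⟩ := hP
  · exact hJ (le_bot_iff.1 hJP)
  · exact hcrit N hN hJP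

/-- Let `D` be an almost Dedekind domain (not a field) with finitely many
critical maximal ideals. Then `D` is not completely unbounded: some nonzero proper
principal ideal of `D` is bounded. -/
theorem statement13 (R : Type*) [CommRing R] [IsDomain R] (hR : ¬ IsField R)
    (hAD : AlmostDedekind R) (hfin : (Crit R).Finite) :
    ∃ a : R, Ideal.span {a} ≠ ⊥ ∧ Ideal.span {a} ≠ ⊤ ∧
      ∃ n : ℕ, ∀ M, nu R (Ideal.span {a}) M ≤ n := by
  have : ∀ N : MaximalSpectrum R, IsDiscreteValuationRing (Localization.AtPrime N.asIdeal) := hAD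
  suffices h : ∃ a : R, a ≠ 0 ∧ ¬ IsUnit a ∧
      ∃ n : ℕ, ∀ N : MaximalSpectrum R, locVal N a ≤ n by
    obtain ⟨a, ha, hunit, n, hn⟩ := h
    exact ⟨a, by simpa using ha, by simpa [Ideal.span_singleton_eq_top] using hunit, n,
      fun M => nu_span_singleton_le M ha (hn M)⟩
  by_cases hall : ∀ N : MaximalSpectrum R, N ∈ Crit R
  · have : Finite (MaximalSpectrum R) :=
      Set.finite_univ_iff.1 (hfin.subset fun N _ => hall N)
    obtain ⟨a, ha, hunit⟩ := Ring.exists_not_isUnit_of_not_isField hR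
    exact ⟨a, ha, hunit, exists_forall_locVal_le_of_finite ha⟩
  · simp only [Crit, Set.mem_ofPred_eq, not_forall, not_not] at hall
    obtain ⟨M, J, hJ, hfg, hrad, hJM⟩ := hall
    obtain ⟨a, haJ, ha, hcrit⟩ := exists_mem_ne_zero_forall_crit_notMem hfin hJ
      fun N hN => hN J hJ hfg hrad
    exact ⟨a, ha, fun hu => M.isMaximal.ne_top (Ideal.eq_top_of_isUnit_mem _ (hJM haJ) hu),
      exists_forall_locVal_le ha hcrit⟩

end ADPaper
end
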